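/- Let C be a category with biaction satisfying (TC4). Then the pseudoproduct ⊗ is associative if and only if C satisfies (TC7), i.e., for all a, b in C and e in C⁰: (TC7a) e|((a|D(b)) ∘ (R(a|D(b))|b)) = (e|a|D(b)) ∘ (R(e|a|D(b))|b), and (TC7b) ((a|D(R(a)|b)) ∘ (R(a)|b))|e = (a|D(R(a)|b|e)) ∘ (R(a)|b|e). -/

import Mathlib

/-- An object-free small category: a set with a partial composition (given by a
composition defined on pairs with matching range/domain identities) and unary
operations `D`, `R`, equipped with a biaction of the identities (the elements of the
form `D x`, equivalently those `e` with `D e = e`) via a left action `la` and a right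
action `ra`, satisfying (TC1), (TC2) and (TC6). -/
structure BiactionCat (C : Type*) where
  D : C → C
  R : C → C
  comp : (x y : C) → R x = D y → C
  rd : ∀ x, R (D x) = D x
  dr : ∀ x, D (R x) = R x
  comp_id_left : ∀ x, comp (D x) x (rd x) = x
  comp_id_right : ∀ x, comp x (R x) (dr x).symm = x
  d_comp : ∀ x y (h : R x = D y), D (comp x y h) = D x
  r_comp : ∀ x y (h : R x = D y), R (comp x y h) = R y
  assoc : ∀ x y z (h1 : R x = D y) (h2 : R y = D z),
    comp (comp x y h1) z ((r_comp x y h1).trans h2) =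
      comp x (comp y z h2) (h1.trans (d_comp y z h2).symm)
  la : C → C → C
  ra : C → C → C
  tc1 : ∀ e f, D e = e → D f = f → la e f = ra e f
  tc2_left : ∀ a, la (D a) a = a
  tc2_right : ∀ a, ra a (R a) = a
  tc6 : ∀ e f a, D e = e → D f = f → ra (la e a) f = la e (ra a f)

namespace BiactionCat

variable {C : Type*} (Γ : BiactionCat C)

/-- (TC4a): whenever `a ∘ b` is defined, for every identity `e` the product
`(e|a) ∘ (R(e|a)|b)` is defined and equals `e|(a ∘ b)`. -/
def TC4a : Prop :=
  ∀ a b (h : Γ.R a = Γ.D b) e, Γ.D e = e →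
    ∃ h2 : Γ.R (Γ.la e a) = Γ.D (Γ.la (Γ.R (Γ.la e a)) b),
      Γ.comp (Γ.la e a) (Γ.la (Γ.R (Γ.la e a)) b) h2 = Γ.la e (Γ.comp a b h)

/-- (TC4b): whenever `a ∘ b` is defined, for every identity `e` the product
`(a|D(b|e)) ∘ (b|e)` is defined and equals `(a ∘ b)|e`. -/
def TC4b : Prop :=
  ∀ a b (h : Γ.R a = Γ.D b) e, Γ.D e = e →
    ∃ h2 : Γ.R (Γ.ra a (Γ.D (Γ.ra b e))) = Γ.D (Γ.ra b e),
      Γ.comp (Γ.ra a (Γ.D (Γ.ra b e))) (Γ.ra b e) h2 = Γ.ra (Γ.comp a b h) e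

/-- (TC4a'): whenever `a ∘ b` is defined, for every identity `e` the product
`((e|a)|D(R(e|a)|b)) ∘ (R(e|a)|b)` is defined and equals `e|(a ∘ b)`. -/
def TC4a' : Prop :=
  ∀ a b (h : Γ.R a = Γ.D b) e, Γ.D e = e →
    ∃ h2 : Γ.R (Γ.ra (Γ.la e a) (Γ.D (Γ.la (Γ.R (Γ.la e a)) b))) =
        Γ.D (Γ.la (Γ.R (Γ.la e a)) b),
      Γ.comp (Γ.ra (Γ.la e a) (Γ.D (Γ.la (Γ.R (Γ.la e a)) b)))
        (Γ.la (Γ.R (Γ.la e a)) b) h2 = Γ.la e (Γ.comp a b h)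

/-- (TC4b'): whenever `a ∘ b` is defined, for every identity `e` the product
`(a|D(b|e)) ∘ (R(a|D(b|e))|(b|e))` is defined and equals `(a ∘ b)|e`. -/
def TC4b' : Prop :=
  ∀ a b (h : Γ.R a = Γ.D b) e, Γ.D e = e →
    ∃ h2 : Γ.R (Γ.ra a (Γ.D (Γ.ra b e))) =
        Γ.D (Γ.la (Γ.R (Γ.ra a (Γ.D (Γ.ra b e)))) (Γ.ra b e)),
      Γ.comp (Γ.ra a (Γ.D (Γ.ra b e)))
        (Γ.la (Γ.R (Γ.ra a (Γ.D (Γ.ra b e)))) (Γ.ra b e)) h2 = Γ.ra (Γ.comp a b h) e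

/-- (TC4) is (TC4a) together with (TC4b). -/
def TC4 : Prop := Γ.TC4a ∧ Γ.TC4b

/-- (TC4L) is (TC4a) together with (TC4b'). -/
def TC4L : Prop := Γ.TC4a ∧ Γ.TC4b'

/-- (TC4R) is (TC4a') together with (TC4b). -/
def TC4R : Prop := Γ.TC4a' ∧ Γ.TC4b

/-- (LMU): `R(s|D(t)) = D(R(s|D(t))|t)` for all `s, t`. -/
def LMU : Prop := ∀ s t, Γ.R (Γ.ra s (Γ.D t)) = Γ.D (Γ.la (Γ.R (Γ.ra s (Γ.D t))) t)

/-- (RMU): `D(R(s)|t) = R(s|D(R(s)|t))` for all `s, t`. -/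
def RMU : Prop := ∀ s t, Γ.D (Γ.la (Γ.R s) t) = Γ.R (Γ.ra s (Γ.D (Γ.la (Γ.R s) t)))

/-- The total extension of the partial composition: `pcomp x y = x ∘ y` when the
product is defined, and junk otherwise. -/
noncomputable def pcomp (x y : C) : C :=
  haveI := Classical.dec (Γ.R x = Γ.D y)
  if h : Γ.R x = Γ.D y then Γ.comp x y h else x

/-- The (left) pseudoproduct `s ⊗ t = (s|D(t)) ∘ (R(s|D(t))|t)`, expressed via the
total extension `pcomp` of the partial composition (the product is genuinely defined
whenever (LMU) holds, in particular under (TC4)). -/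
noncomputable def otimes (s t : C) : C :=
  Γ.pcomp (Γ.ra s (Γ.D t)) (Γ.la (Γ.R (Γ.ra s (Γ.D t))) t)

end BiactionCat

namespace BiactionCat

variable {C : Type*} {Γ : BiactionCat C}

theorem pcomp_eq_comp {x y : C} (h : Γ.R x = Γ.D y) : Γ.pcomp x y = Γ.comp x y h :=
  dif_pos h

theorem D_pcomp {x y : C} (h : Γ.R x = Γ.D y) : Γ.D (Γ.pcomp x y) = Γ.D x := by
  rw [pcomp_eq_comp h, Γ.d_comp]

theorem R_pcomp {x y : C} (h : Γ.R x = Γ.D y) : Γ.R (Γ.pcomp x y) = Γ.R y := by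
  rw [pcomp_eq_comp h, Γ.r_comp]

theorem pcomp_assoc {x y z : C} (h₁ : Γ.R x = Γ.D y) (h₂ : Γ.R y = Γ.D z) :
    Γ.pcomp (Γ.pcomp x y) z = Γ.pcomp x (Γ.pcomp y z) := by
  rw [pcomp_eq_comp h₁, pcomp_eq_comp h₂, pcomp_eq_comp ((Γ.r_comp x y h₁).trans h₂),
    pcomp_eq_comp (h₁.trans (Γ.d_comp y z h₂).symm)]
  exact Γ.assoc x y z h₁ h₂

theorem D_D (x : C) : Γ.D (Γ.D x) = Γ.D x := by
  rw [← Γ.rd x, Γ.dr]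

theorem D_pcomp_self (x : C) : Γ.pcomp (Γ.D x) x = x := by
  rw [pcomp_eq_comp (Γ.rd x), Γ.comp_id_left]

theorem pcomp_R_self (x : C) : Γ.pcomp x (Γ.R x) = x := by
  rw [pcomp_eq_comp (Γ.dr x).symm, Γ.comp_id_right]

/-- The action of an identity on the left of `D a ∘ a`. -/
theorem TC4a.la_eq (h : Γ.TC4a) (a : C) {e : C} (he : Γ.D e = e) :
    Γ.R (Γ.la e (Γ.D a)) = Γ.D (Γ.la (Γ.R (Γ.la e (Γ.D a))) a) ∧
      Γ.pcomp (Γ.la e (Γ.D a)) (Γ.la (Γ.R (Γ.la e (Γ.D a))) a) = Γ.la e a := by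
  obtain ⟨h₁, h₂⟩ := h (Γ.D a) a (Γ.rd a) e he
  exact ⟨h₁, by rw [pcomp_eq_comp h₁, h₂, Γ.comp_id_left]⟩

/-- The action of an identity on the right of `a ∘ R a`. -/
theorem TC4b.ra_eq (h : Γ.TC4b) (a : C) {e : C} (he : Γ.D e = e) :
    Γ.R (Γ.ra a (Γ.D (Γ.ra (Γ.R a) e))) = Γ.D (Γ.ra (Γ.R a) e) ∧
      Γ.pcomp (Γ.ra a (Γ.D (Γ.ra (Γ.R a) e))) (Γ.ra (Γ.R a) e) = Γ.ra a e := by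
  obtain ⟨h₁, h₂⟩ := h a (Γ.R a) (Γ.dr a).symm e he
  exact ⟨h₁, by rw [pcomp_eq_comp h₁, h₂, Γ.comp_id_right]⟩

theorem TC4a.D_la (h : Γ.TC4a) (a : C) {e : C} (he : Γ.D e = e) :
    Γ.D (Γ.la e a) = Γ.D (Γ.la e (Γ.D a)) := by
  rw [← (h.la_eq a he).2, D_pcomp (h.la_eq a he).1]

theorem TC4b.R_ra (h : Γ.TC4b) (a : C) {e : C} (he : Γ.D e = e) :
    Γ.R (Γ.ra a e) = Γ.R (Γ.ra (Γ.R a) e) := by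
  rw [← (h.ra_eq a he).2, R_pcomp (h.ra_eq a he).1]

theorem TC4.lmu (h : Γ.TC4) : Γ.LMU := by
  intro s t
  rw [h.2.R_ra s (D_D t), ← Γ.tc1 _ _ (Γ.dr s) (D_D t)]
  exact (h.1.la_eq t (Γ.dr s)).1

theorem TC4.rmu (h : Γ.TC4) : Γ.RMU := by
  intro s t
  rw [h.1.D_la t (Γ.dr s), Γ.tc1 _ _ (Γ.dr s) (D_D t)]
  exact (h.2.ra_eq s (D_D t)).1.symm

/-- The left and right forms of the pseudoproduct coincide. -/
theorem TC4.otimes_eq (h : Γ.TC4) (s t : C) :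
    Γ.otimes s t = Γ.pcomp (Γ.ra s (Γ.D (Γ.la (Γ.R s) t))) (Γ.la (Γ.R s) t) := by
  have hs := h.2.ra_eq s (D_D t)
  have ht := h.1.la_eq t (Γ.dr s)
  have h_tc1 := Γ.tc1 _ _ (Γ.dr s) (D_D t)
  have hR := h.2.R_ra s (D_D t)
  rw [h_tc1] at ht
  rw [otimes, hR, h.1.D_la t (Γ.dr s), h_tc1, ← hs.2, ← ht.2]
  exact pcomp_assoc hs.1 ht.1

theorem TC4.otimes_of_D_eq (h : Γ.TC4) (a : C) {e : C} (he : Γ.D e = e) :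
    Γ.otimes e a = Γ.la e a := by
  rw [otimes, ← Γ.tc1 _ _ he (D_D a)]
  exact (h.1.la_eq a he).2

theorem TC4.otimes_of_D_eq_right (h : Γ.TC4) (a : C) {e : C} (he : Γ.D e = e) :
    Γ.otimes a e = Γ.ra a e := by
  rw [h.otimes_eq, Γ.tc1 _ _ (Γ.dr a) he]
  exact (h.2.ra_eq a he).2

/-- Associativity of the pseudoproduct follows from the cases in which the left or the
right factor is an identity. -/
theorem TC4.otimes_assoc (h : Γ.TC4)
    (hl : ∀ a b e, Γ.D e = e → Γ.la e (Γ.otimes a b) = Γ.otimes (Γ.la e a) b)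
    (hr : ∀ a b e, Γ.D e = e → Γ.ra (Γ.otimes a b) e = Γ.otimes a (Γ.ra b e)) (a b c : C) :
    Γ.otimes (Γ.otimes a b) c = Γ.otimes a (Γ.otimes b c) := by
  have h₁ := (h.rmu a (Γ.ra b (Γ.D c))).symm
  have h₂ := h.lmu (Γ.la (Γ.R a) b) c
  have h_tc6 := Γ.tc6 _ _ b (Γ.dr a) (D_D c)
  have hD : Γ.D (Γ.la (Γ.R a) (Γ.otimes b c)) = Γ.D (Γ.la (Γ.R a) (Γ.ra b (Γ.D c))) := by
    rw [hl _ _ _ (Γ.dr a), otimes, D_pcomp h₂, h_tc6]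
  have hR : Γ.R (Γ.otimes a (Γ.ra b (Γ.D c))) = Γ.R (Γ.la (Γ.R a) (Γ.ra b (Γ.D c))) := by
    rw [h.otimes_eq, R_pcomp h₁]
  rw [h_tc6] at h₂
  rw [h.otimes_eq a (Γ.otimes b c), hD, hl _ _ _ (Γ.dr a)]
  rw [otimes, hr _ _ _ (D_D c), hR, h.otimes_eq, pcomp_assoc h₁ h₂, otimes, h_tc6]

end BiactionCat

/-- Let C be a category with biaction satisfying (TC4).  Then the
pseudoproduct ⊗ is associative iff C satisfies (TC7), consisting of
(TC7a) e|((a|D(b)) ∘ (R(a|D(b))|b)) = (e|a|D(b)) ∘ (R(e|a|D(b))|b) and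
(TC7b) ((a|D(R(a)|b)) ∘ (R(a)|b))|e = (a|D(R(a)|b|e)) ∘ (R(a)|b|e),
for all a, b in C and e in C⁰ (all the products involved being defined under (TC4)). -/
theorem TC4_otimes_assoc_iff_TC7
    {C : Type*} (Γ : BiactionCat C) (h4 : Γ.TC4) :
    (∀ a b c : C, Γ.otimes (Γ.otimes a b) c = Γ.otimes a (Γ.otimes b c)) ↔
    ((∀ (a b e : C), Γ.D e = e →
        Γ.la e (Γ.pcomp (Γ.ra a (Γ.D b)) (Γ.la (Γ.R (Γ.ra a (Γ.D b))) b)) =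
          Γ.pcomp (Γ.ra (Γ.la e a) (Γ.D b)) (Γ.la (Γ.R (Γ.ra (Γ.la e a) (Γ.D b))) b)) ∧
      (∀ (a b e : C), Γ.D e = e →
        Γ.ra (Γ.pcomp (Γ.ra a (Γ.D (Γ.la (Γ.R a) b))) (Γ.la (Γ.R a) b)) e =
          Γ.pcomp (Γ.ra a (Γ.D (Γ.ra (Γ.la (Γ.R a) b) e))) (Γ.ra (Γ.la (Γ.R a) b) e))) := by
  have hR (a b e : C) (he : Γ.D e = e) :
      Γ.pcomp (Γ.ra a (Γ.D (Γ.ra (Γ.la (Γ.R a) b) e))) (Γ.ra (Γ.la (Γ.R a) b) e) =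
        Γ.otimes a (Γ.ra b e) := by
    rw [h4.otimes_eq, Γ.tc6 _ _ b (Γ.dr a) he]
  constructor
  · intro h
    refine ⟨fun a b e he => ?_, fun a b e he => ?_⟩
    · change Γ.la e (Γ.otimes a b) = Γ.otimes (Γ.la e a) b
      rw [← h4.otimes_of_D_eq _ he, ← h4.otimes_of_D_eq _ he, h]
    · rw [← h4.otimes_eq, hR a b e he, ← h4.otimes_of_D_eq_right _ he,
        ← h4.otimes_of_D_eq_right _ he, h]
  · rintro ⟨hl, hr⟩
    refine h4.otimes_assoc hl fun a b e he => ?_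
    rw [h4.otimes_eq a b, hr a b e he, hR a b e he]
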